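/- Let r ∈ ℕ, let A ⊆ ℕ be an IP* set, and let B ⊆ ℕ be an IP_r* set. Then there exists k ∈ ℕ such that every positive multiple of k can be written as a product a·b with a ∈ A and b ∈ B, i.e. k·ℕ ⊆ A·B. -/

import Mathlib

/-- `FS ⟨xₙ⟩` : all finite sums `Σ_{t ∈ H} x_t` over nonempty finite `H ⊆ ℕ`. -/
def FS (x : ℕ → ℕ) : Set ℕ :=
  { y | ∃ H : Finset ℕ, H.Nonempty ∧ y = ∑ t ∈ H, x t }

/-- `S` is an IP set (in the positive integers) if it contains `FS ⟨xₙ⟩` for some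
sequence of positive integers `⟨xₙ⟩`. -/
def IPSet (S : Set ℕ) : Prop :=
  ∃ x : ℕ → ℕ, (∀ n, 0 < x n) ∧ FS x ⊆ S

/-- `A` is IP* if it meets every IP set. -/
def IPStar (A : Set ℕ) : Prop :=
  ∀ S : Set ℕ, IPSet S → (A ∩ S).Nonempty

/-- `S` is an IP_r set if it contains all sums `Σ_{t ∈ H} x_t` over nonempty
`H ⊆ {1, …, r}`, for some positive integers `x₁, …, x_r`. -/
def IPrSet (r : ℕ) (S : Set ℕ) : Prop :=
  ∃ x : ℕ → ℕ, (∀ n, 0 < x n) ∧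
    ∀ H : Finset ℕ, H.Nonempty → H ⊆ Finset.Icc 1 r → (∑ t ∈ H, x t) ∈ S

/-- `A` is IP_r* if it meets every IP_r set. -/
def IPrStar (r : ℕ) (A : Set ℕ) : Prop :=
  ∀ S : Set ℕ, IPrSet r S → (A ∩ S).Nonempty

theorem hindman_FS_pos {a : Stream' ℕ} {m : ℕ} (h : m ∈ Hindman.FS a) :
    (∀ i, 0 < a.get i) → 0 < m := by
  induction h with
  | head' a => intro ha; exact ha 0
  | tail' a m _ ih => intro ha; exact ih (fun i => ha (i + 1))
  | cons' a m _ ih =>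
    intro ha
    exact Nat.add_pos_left (ha 0) _

/-- Simultaneous dilations: an IP* set contains `d * m` for all `d` in a finite set. -/
theorem IPStar.exists_common {A : Set ℕ} (hA : IPStar A) (D : Finset ℕ)
    (hD : ∀ d ∈ D, 0 < d) : ∃ m, 0 < m ∧ ∀ d ∈ D, d * m ∈ A := by
  by_contra! hcon
  let C : ℕ → Set ℕ := fun d => {m | 0 < m ∧ d * m ∉ A}
  obtain ⟨c, hc, b, hb⟩ := Hindman.FS_partition_regular (Stream'.const 1)
    (Set.image C (D : Set ℕ)) (D.finite_toSet.image C) (by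
      intro m hm
      have hm0 : 0 < m := hindman_FS_pos hm (fun i => by simp)
      obtain ⟨d, hd, hdm⟩ := hcon m hm0
      exact ⟨C d, ⟨d, hd, rfl⟩, hm0, hdm⟩)
  obtain ⟨d, hd, rfl⟩ := hc
  obtain ⟨y, hyA, H, hH, rfl⟩ := hA (FS fun i => d * b.get i)
    ⟨fun i => d * b.get i,
      fun i => Nat.mul_pos (hD d hd) (hb (Hindman.FS.singleton b i)).1, subset_rfl⟩
  rw [← Finset.mul_sum] at hyA
  exact (hb (Hindman.FS.finsetSum b H hH)).2 hyA

/-- **Main theorem.** If `A ⊆ ℕ` is IP* and `B ⊆ ℕ` is IP_r*, then there exists a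
positive integer `k` with `k·ℕ ⊆ A·B`. -/
theorem exists_mulN_subset_mul_of_IPStar_IPrStar
    (r : ℕ) (A B : Set ℕ) (hA : IPStar A) (hB : IPrStar r B) :
    ∃ k : ℕ, 0 < k ∧ ∀ n : ℕ, 0 < n → ∃ a ∈ A, ∃ b ∈ B, k * n = a * b := by
  have hdvd : ∀ s ∈ Finset.Icc 1 r, s ∣ r.factorial := fun s hs => by
    rw [Finset.mem_Icc] at hs
    exact Nat.dvd_factorial hs.1 hs.2
  obtain ⟨m, hm, hmA⟩ := hA.exists_common ((Finset.Icc 1 r).image fun s => r.factorial / s) (by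
    intro d hd
    obtain ⟨s, hs, rfl⟩ := Finset.mem_image.1 hd
    exact Nat.div_pos (Nat.le_of_dvd r.factorial_pos (hdvd s hs)) (Finset.mem_Icc.1 hs).1)
  refine ⟨r.factorial * m, Nat.mul_pos r.factorial_pos hm, fun n hn => ?_⟩
  obtain ⟨y, hyB, s, hs, rfl⟩ := hB {y | ∃ s ∈ Finset.Icc 1 r, y = s * n}
    ⟨fun _ => n, fun _ => hn, fun H hH hHr =>
      ⟨H.card, Finset.mem_Icc.2 ⟨hH.card_pos, by simpa using Finset.card_le_card hHr⟩,
        by simp⟩⟩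
  refine ⟨_, hmA _ (Finset.mem_image_of_mem _ hs), _, hyB, ?_⟩
  obtain ⟨t, ht⟩ := hdvd s hs
  rw [ht, Nat.mul_div_cancel_left t (Finset.mem_Icc.1 hs).1]
  ring
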